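/- Let T = (T_1, …, T_d) be a jointly hyponormal commuting d-tuple of bounded operators on a complex separable Hilbert space H, and suppose that each single operator T_i is m_i-polynomially cyclic. Then each commutator [T_j*, T_i] is trace class, and ‖[T_i*, T_i]‖₁ ≤ (m_i/π) ν(σ(T_i)), while for i ≠ j, ‖[T_j*, T_i]‖₁ ≤ ((m_i/π) ν(σ(T_i)))^{1/2} ((m_j/π) ν(σ(T_j)))^{1/2}, where σ(T_i) is the spectrum of T_i and ν is planar Lebesgue measure on ℂ. -/

import Mathlib

open ContinuousLinearMap MeasureTheory
open scoped ENNReal NNReal ComplexOrder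

noncomputable section

variable {H H₁ H₂ K : Type*}
variable [NormedAddCommGroup H] [InnerProductSpace ℂ H] [CompleteSpace H]
variable [NormedAddCommGroup H₁] [InnerProductSpace ℂ H₁] [CompleteSpace H₁]
variable [NormedAddCommGroup H₂] [InnerProductSpace ℂ H₂] [CompleteSpace H₂]
variable [NormedAddCommGroup K] [InnerProductSpace ℂ K] [CompleteSpace K]

/-- The commutator `[A, B] = A * B - B * A` of two bounded operators. -/
def cmt (A B : H →L[ℂ] H) : H →L[ℂ] H := A * B - B * A

/-- A bounded operator `T` is hyponormal if `[T*, T] ≥ 0`. -/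
def Hyponormal (T : H →L[ℂ] H) : Prop := (cmt (adjoint T) T).IsPositive

/-- A `d`-tuple is projectively hyponormal if every linear combination is hyponormal. -/
def ProjHyponormal {d : ℕ} (T : Fin d → H →L[ℂ] H) : Prop :=
  ∀ α : Fin d → ℂ, Hyponormal (∑ i, α i • T i)

/-- A `d`-tuple is jointly hyponormal if the block operator `(([T j*, T i]))` is
non-negative definite on the `d`-fold direct sum. -/
def JointlyHyponormal {d : ℕ} (T : Fin d → H →L[ℂ] H) : Prop :=
  ∀ x : Fin d → H, 0 ≤ ∑ i, ∑ j, @inner ℂ _ _ (x i) (cmt (adjoint (T j)) (T i) (x j))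

/-- The trace norm `‖T‖₁ = sup Σ |⟨T fᵢ, gᵢ⟩|`, the supremum being taken over all pairs of
(finite) orthonormal families. -/
def traceNorm (T : H →L[ℂ] H) : ℝ≥0∞ :=
  ⨆ (n : ℕ) (f : Fin n → H) (g : Fin n → H) (_ : Orthonormal ℂ f) (_ : Orthonormal ℂ g),
    ∑ i, (‖@inner ℂ _ _ (T (f i)) (g i)‖₊ : ℝ≥0∞)

/-- A bounded operator is trace class if its trace norm is finite. -/
def IsTraceClass (T : H →L[ℂ] H) : Prop := traceNorm T ≠ ⊤

/-- The Hilbert-Schmidt norm `‖T‖₂ = (Σ ‖T eₙ‖²)^(1/2)`. -/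
def hsNorm (T : H →L[ℂ] H) : ℝ≥0∞ :=
  (⨆ (n : ℕ) (f : Fin n → H) (_ : Orthonormal ℂ f), ∑ i, (‖T (f i)‖₊ : ℝ≥0∞) ^ 2) ^ (1/2 : ℝ)

/-- The word `T₁^(n 1) ⋯ T d^(n d)` in a `d`-tuple of operators. -/
def opWord {d : ℕ} (T : Fin d → H →L[ℂ] H) (n : Fin d → ℕ) : H →L[ℂ] H :=
  (List.ofFn fun j => (T j) ^ (n j)).prod

/-- A single operator is `m`-polynomially cyclic if `m` is the least cardinality of a finite
set `ξ` such that the span of `{T^n v : v ∈ ξ, n ≥ 0}` is dense. -/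
def IsPolyCyclicOp (T : H →L[ℂ] H) (m : ℕ) : Prop :=
  IsLeast {k : ℕ | ∃ ξ : Finset H, ξ.card = k ∧
    Dense ((Submodule.span ℂ {x | ∃ v ∈ ξ, ∃ n : ℕ, x = (T ^ n) v} : Submodule ℂ H) : Set H)} m

/-- A commuting `d`-tuple is `m`-polynomially cyclic if `m` is the least cardinality of a finite
set `ξ` such that the span of `{T₁^{i₁} ⋯ T_d^{i_d} v : v ∈ ξ}` is dense. -/
def IsPolyCyclicTuple {d : ℕ} (T : Fin d → H →L[ℂ] H) (m : ℕ) : Prop :=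
  IsLeast {k : ℕ | ∃ ξ : Finset H, ξ.card = k ∧
    Dense ((Submodule.span ℂ {x | ∃ v ∈ ξ, ∃ n : Fin d → ℕ, x = opWord T n v} :
      Submodule ℂ H) : Set H)} m

/-- The determinant operator `dEt [[T*, T]]` of the block operator of commutators
`B i j = [T j*, T i]`, given by the symmetrized Laplace expansion. -/
def detOp {d : ℕ} (T : Fin d → H →L[ℂ] H) : H →L[ℂ] H :=
  ∑ σ : Equiv.Perm (Fin d), ∑ τ : Equiv.Perm (Fin d),
    ((Equiv.Perm.sign σ : ℤ) •
      (List.ofFn fun k => cmt (adjoint (T (σ (τ k)))) (T (τ k))).prod)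

/-- The standard polynomial `S n (A 1, …, A n) = Σ_σ sgn σ • A σ(1) ⋯ A σ(n)`. -/
def stdPoly {n : ℕ} (A : Fin n → H →L[ℂ] H) : H →L[ℂ] H :=
  ∑ σ : Equiv.Perm (Fin n), ((Equiv.Perm.sign σ : ℤ) • (List.ofFn fun k => A (σ k)).prod)

/-- The generalized commutator `GC(T*, T) = S_{2d}(T₁*, T₁, …, T_d*, T_d)` of Helton-Howe. -/
def genComm {d : ℕ} (T : Fin d → H →L[ℂ] H) : H →L[ℂ] H :=
  stdPoly (fun j : Fin (2 * d) =>
    if (j : ℕ) % 2 = 0 then adjoint (T ⟨(j : ℕ) / 2, by have := j.isLt; omega⟩)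
    else T ⟨(j : ℕ) / 2, by have := j.isLt; omega⟩)

/-- `P` is the orthogonal projection onto the subspace `K'`. -/
def IsOrthProjOn (P : H →L[ℂ] H) (K' : Submodule ℂ H) : Prop :=
  IsSelfAdjoint P ∧ (∀ x, P x ∈ K') ∧ (∀ x ∈ K', P x = x)

/-- The subspace `H_N` spanned by words of total degree at most `N` applied to `ξ`. -/
def HN {d : ℕ} (T : Fin d → H →L[ℂ] H) (ξ : Finset H) (N : ℕ) : Submodule ℂ H :=
  Submodule.span ℂ {x | ∃ v ∈ ξ, ∃ n : Fin d → ℕ, (∑ j, n j) ≤ N ∧ x = opWord T n v}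

/-- The word `T*_{η 1} T_{τ 1} T*_{η 2} T_{τ 2} ⋯ T_{τ (d-1)} T*_{η d}`. -/
def wordB {d : ℕ} (T : Fin d → H →L[ℂ] H) (η τ : Equiv.Perm (Fin d)) : H →L[ℂ] H :=
  (List.ofFn fun k : Fin d =>
    if (k : ℕ) + 1 = d then adjoint (T (η k)) else adjoint (T (η k)) * T (τ k)).prod

/-- The operator `P_N (Σ_η sgn η T*_{η 1} T_{τ 1} ⋯ T*_{η d}) P_N^⊥ T_{τ d} P_N`. -/
def bsExpr {d : ℕ} (hd : 0 < d) (T : Fin d → H →L[ℂ] H) (P : ℕ → H →L[ℂ] H)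
    (τ : Equiv.Perm (Fin d)) (N : ℕ) : H →L[ℂ] H :=
  P N * (∑ η : Equiv.Perm (Fin d), (Equiv.Perm.sign η : ℤ) • wordB T η τ) *
    ((1 - P N) * T (τ ⟨d - 1, by omega⟩) * P N)

/-- The class `BS_{m, θ}`. -/
def InBS {d : ℕ} (hd : 0 < d) (T : Fin d → H →L[ℂ] H) (m θ : ℕ) : Prop :=
  IsPolyCyclicTuple T m ∧ (detOp T).IsPositive ∧
  ∃ ξ : Finset H, ξ.card = m ∧
    Dense ((Submodule.span ℂ {x | ∃ v ∈ ξ, ∃ n : Fin d → ℕ, x = opWord T n v} :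
      Submodule ℂ H) : Set H) ∧
    ∃ P : ℕ → H →L[ℂ] H, (∀ N, IsOrthProjOn (P N) (HN T ξ N)) ∧
      (∀ (N : ℕ) (j : Fin d), P N * T j * (1 - P N) = 0) ∧
      (∀ (τ : Equiv.Perm (Fin d)) (N : ℕ),
        ‖bsExpr hd T P τ N‖ ≤
          (θ : ℝ) * (((N + d - 1).choose (d - 1) : ℝ))⁻¹ * ∏ i, ‖T i‖ ^ 2)

/-- Evaluation of a polynomial in `d` commuting variables on a commuting `d`-tuple. -/
def evalPoly {d : ℕ} (T : Fin d → H →L[ℂ] H) (p : MvPolynomial (Fin d) ℂ) : H →L[ℂ] H :=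
  ∑ mo ∈ p.support, MvPolynomial.coeff mo p • opWord T (fun i => mo i)

/-- A pure hyponormal operator: no nonzero closed subspace, reducing for `T`, on which `T`
restricts to a normal operator. -/
def IsPureHyponormal (T : H →L[ℂ] H) : Prop :=
  Hyponormal T ∧ ∀ K' : Submodule ℂ H, IsClosed (K' : Set H) →
    (∀ x ∈ K', T x ∈ K') → (∀ x ∈ K', adjoint T x ∈ K') →
    (∀ x ∈ K', ‖T x‖ = ‖adjoint T x‖) → K' = ⊥

/-- `tmul` realises `H` as the Hilbert space tensor product of `H₁` and `H₂`. -/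
structure IsHilbertTensor (tmul : H₁ →ₗ[ℂ] H₂ →ₗ[ℂ] H) : Prop where
  inner_tmul : ∀ x₁ x₂ y₁ y₂,
    @inner ℂ _ _ (tmul x₁ x₂) (tmul y₁ y₂) = @inner ℂ _ _ x₁ y₁ * @inner ℂ _ _ x₂ y₂
  dense_span :
    Dense ((Submodule.span ℂ {z | ∃ x y, z = tmul x y} : Submodule ℂ H) : Set H)

/-- `C` is the tensor product operator `A ⊗ B` relative to `tmul`. -/
def IsTensorOp (tmul : H₁ →ₗ[ℂ] H₂ →ₗ[ℂ] H) (A : H₁ →L[ℂ] H₁) (B : H₂ →L[ℂ] H₂)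
    (C : H →L[ℂ] H) : Prop :=
  ∀ x y, C (tmul x y) = tmul (A x) (B y)

set_option linter.unusedSectionVars false

/-- The quadratic form of the self-commutator. -/
def dfc (A : K →L[ℂ] K) (x : K) : ℝ := ‖A x‖ ^ 2 - ‖adjoint A x‖ ^ 2

lemma dfc_continuous (A : K →L[ℂ] K) : Continuous (dfc A) := by
  unfold dfc; fun_prop

lemma dfc_eq_inner (A : K →L[ℂ] K) (x : K) :
    ((dfc A x : ℝ) : ℂ) = inner ℂ x ((adjoint A * A - A * adjoint A) x) := by
  have h1 : inner ℂ x (adjoint A (A x)) = ((‖A x‖ ^ 2 : ℝ) : ℂ) := by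
    rw [ContinuousLinearMap.adjoint_inner_right, inner_self_eq_norm_sq_to_K]; push_cast; rfl
  have h2 : inner ℂ x (A (adjoint A x)) = ((‖adjoint A x‖ ^ 2 : ℝ) : ℂ) := by
    rw [← ContinuousLinearMap.adjoint_inner_left, inner_self_eq_norm_sq_to_K]; push_cast; rfl
  simp only [_root_.sub_apply, mul_apply_eq_comp, inner_sub_right, h1, h2,
    dfc]
  push_cast; rfl

/-- Diagonalization of the self-commutator form on a finite-dimensional subspace. -/
lemma exists_diag (A : K →L[ℂ] K) (F : Submodule ℂ K) [FiniteDimensional ℂ F] :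
    ∃ (n : ℕ) (b : OrthonormalBasis (Fin n) ℂ F),
      ∀ x : F, dfc A x = ∑ k, dfc A (b k) * ‖inner ℂ (b k) x‖ ^ 2 := by
  set C : K →L[ℂ] K := adjoint A * A - A * adjoint A with hC
  have hCs : ∀ x y : K, inner ℂ (C x) y = inner ℂ x (C y) := by
    intro x y
    simp only [hC, _root_.sub_apply, mul_apply_eq_comp, inner_sub_right,
      inner_sub_left, ContinuousLinearMap.adjoint_inner_left,
      ContinuousLinearMap.adjoint_inner_right]
    rw [← ContinuousLinearMap.adjoint_inner_right A (adjoint A x) y,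
      ContinuousLinearMap.adjoint_inner_left]
  let G : F →ₗ[ℂ] F := (F.orthogonalProjectionOnto ∘L C ∘L F.subtypeL).toLinearMap
  have hG : ∀ x y : F, inner ℂ x (G y) = inner ℂ (x : K) (C y) := by
    intro x y
    simp [G]
  have hGs : G.IsSymmetric := by
    intro x y
    rw [hG, ← inner_conj_symm, hG, inner_conj_symm, hCs]
  refine ⟨_, hGs.eigenvectorBasis rfl, ?_⟩
  set b := hGs.eigenvectorBasis rfl
  set l := hGs.eigenvalues rfl
  have hb : ∀ k, G (b k) = (l k : ℂ) • b k := fun k => hGs.apply_eigenvectorBasis rfl k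
  have key : ∀ x : F, dfc A x = ∑ k, l k * ‖inner ℂ (b k) x‖ ^ 2 := by
    intro x
    have : ((dfc A x : ℝ) : ℂ) = ((∑ k, l k * ‖inner ℂ (b k) x‖ ^ 2 : ℝ) : ℂ) := by
      rw [dfc_eq_inner, ← hC, ← hG, ← b.sum_inner_mul_inner]
      push_cast
      refine Finset.sum_congr rfl fun k _ => ?_
      rw [← hGs, hb, inner_smul_left, Complex.conj_ofReal]
      rw [← inner_conj_symm x (b k), mul_left_comm, Complex.conj_mul']
    exact_mod_cast this
  have hl : ∀ k, dfc A (b k) = l k := by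
    intro k
    rw [key]
    rw [Finset.sum_eq_single k]
    · simp
    · intro j _ hj
      simp [b.orthonormal.2 hj]
    · simp
  intro x
  rw [key]; simp only [hl]

lemma fin_bound (A : K →L[ℂ] K) (hA : ∀ x, 0 ≤ dfc A x) (F : Submodule ℂ K)
    [FiniteDimensional ℂ F] {m : ℕ} (u : Fin m → K)
    (hF : ∀ x ∈ F, A x ∈ F ⊔ Submodule.span ℂ (Set.range u))
    {ι : Type*} [Fintype ι] (f : ι → K) (hf : Orthonormal ℂ f) :
    ∑ i, dfc A (F.starProjection (f i)) ≤ m * ‖A‖ ^ 2 := by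
  obtain ⟨n, b, hb⟩ := exists_diag A F
  have hinner : ∀ k x, inner ℂ (b k) (F.orthogonalProjectionOnto x) = inner ℂ (b k : K) x := by
    intro k x; simp
  have h1 : ∑ i, dfc A (F.starProjection (f i)) ≤ ∑ k, dfc A (b k) := by
    have : ∀ i, dfc A (F.starProjection (f i)) = ∑ k, dfc A (b k) * ‖inner ℂ (f i) (b k : K)‖ ^ 2 := by
      intro i
      have := hb (F.orthogonalProjectionOnto (f i))
      simp only [hinner] at this
      simp only [norm_inner_symm (f i)]
      exact this
    simp only [this]
    rw [Finset.sum_comm]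
    refine Finset.sum_le_sum fun k _ => ?_
    rw [← Finset.mul_sum]
    refine mul_le_of_le_one_right (hA _) ?_
    refine (hf.sum_inner_products_le _).trans ?_
    have : ‖(b k : K)‖ = 1 := b.orthonormal.1 k
    simp [this]
  refine h1.trans ?_
  -- the part outside of F
  let Q : K →L[ℂ] K := ContinuousLinearMap.id ℂ K - F.starProjection
  have hnorm : ∀ x, ‖x‖ ^ 2 = ∑ l, ‖inner ℂ (b l : K) x‖ ^ 2 + ‖Q x‖ ^ 2 := by
    intro x
    have e1 := b.sum_sq_norm_inner_right (F.orthogonalProjectionOnto x)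
    simp only [hinner] at e1
    rw [e1]
    have := Submodule.norm_sq_eq_add_norm_sq_starProjection x F
    rw [Submodule.starProjection_orthogonal'] at this
    exact this
  have h2 : ∑ k, dfc A (b k) ≤ ∑ k, ‖Q (A (b k))‖ ^ 2 := by
    unfold dfc
    rw [Finset.sum_sub_distrib, sub_le_iff_le_add]
    have e1 : ∑ k, ‖A (b k)‖ ^ 2 = ∑ k, (∑ l, ‖inner ℂ (b l : K) (A (b k))‖ ^ 2) + ∑ k, ‖Q (A (b k))‖ ^ 2 := by
      rw [← Finset.sum_add_distrib]
      exact Finset.sum_congr rfl fun k _ => hnorm _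
    rw [e1, add_comm, Finset.sum_comm]
    gcongr with k
    rw [hnorm (adjoint A (b k))]
    refine le_add_of_le_of_nonneg (le_of_eq ?_) (by positivity)
    refine Finset.sum_congr rfl fun l _ => ?_
    rw [ContinuousLinearMap.adjoint_inner_right, norm_inner_symm]
  refine h2.trans ?_
  let W : Submodule ℂ K := Submodule.span ℂ (Set.range fun i => Q (u i))
  have hQF : ∀ x ∈ F, Q x = 0 := by
    intro x hx
    simp [Q, Submodule.starProjection_eq_self_iff.2 hx]
  have hW : ∀ k, Q (A (b k)) ∈ W := by
    intro k
    obtain ⟨y, hy, z, hz, hyz⟩ := Submodule.mem_sup.1 (hF (b k) (b k).2)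
    rw [← hyz, map_add, hQF y hy, zero_add]
    have : (Submodule.span ℂ (Set.range u)).map Q.toLinearMap ≤ W := by
      rw [Submodule.map_span, ← Set.range_comp]
      exact le_of_eq rfl
    exact this ⟨z, hz, rfl⟩
  have : FiniteDimensional ℂ W := FiniteDimensional.span_of_finite ℂ (Set.finite_range _)
  have hrank : Module.finrank ℂ W ≤ m := by
    have := finrank_range_le_card (R := ℂ) (fun i => Q (u i))
    rw [Fintype.card_fin] at this
    exact this
  have hQs : ∀ x y, inner ℂ (Q x) y = inner ℂ x (Q y) := by
    intro x y
    simp only [Q, _root_.sub_apply, inner_sub_left, inner_sub_right,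
      Submodule.inner_starProjection_left_eq_right, ContinuousLinearMap.id_apply]
  let c := stdOrthonormalBasis ℂ W
  have hc : ∀ k, ‖Q (A (b k))‖ ^ 2 = ∑ l, ‖inner ℂ (b k : K) (adjoint A (Q (c l)))‖ ^ 2 := by
    intro k
    have := c.sum_sq_norm_inner_right ⟨_, hW k⟩
    simp only [Submodule.coe_inner, Submodule.coe_norm] at this
    rw [← this]
    refine Finset.sum_congr rfl fun l _ => ?_
    rw [ContinuousLinearMap.adjoint_inner_right, ← hQs, norm_inner_symm]
  have hQn : ∀ x, ‖Q x‖ ≤ ‖x‖ := by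
    intro x
    have := hnorm x
    have h0 : 0 ≤ ∑ l, ‖inner ℂ (b l : K) x‖ ^ 2 := by positivity
    exact le_of_sq_le_sq (by linarith) (norm_nonneg _)
  have hbo : Orthonormal ℂ (fun k => (b k : K)) := 
    b.orthonormal.comp_linearIsometry F.subtypeₗᵢ
  simp only [hc]
  rw [Finset.sum_comm]
  calc ∑ l, ∑ k, ‖inner ℂ (b k : K) (adjoint A (Q (c l)))‖ ^ 2
      ≤ ∑ l : Fin (Module.finrank ℂ W), ‖A‖ ^ 2 := by
        refine Finset.sum_le_sum fun l _ => ?_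
        refine (hbo.sum_inner_products_le _).trans ?_
        gcongr
        refine (ContinuousLinearMap.le_opNorm _ _).trans ?_
        rw [LinearIsometryEquiv.norm_map]
        have : ‖(c l : K)‖ = 1 := c.orthonormal.1 l
        have := hQn (c l)
        exact mul_le_of_le_one_right (norm_nonneg _) (by linarith)
    _ ≤ m * ‖A‖ ^ 2 := by
        rw [Finset.sum_const, nsmul_eq_mul]
        gcongr
        simpa using hrank

/-- Polynomials without zeros on `Z`. -/
def NZ (Z : Set ℂ) (q : Polynomial ℂ) : Prop := ∀ z ∈ Z, q.eval z ≠ 0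

/-- Rational cyclicity with poles off `Z`. -/
def RCyc (A : K →L[ℂ] K) {m : ℕ} (w : Fin m → K) (Z : Set ℂ) : Prop :=
  ∀ M : Submodule ℂ K, IsClosed (M : Set K) → (∀ i, w i ∈ M) → (∀ x ∈ M, A x ∈ M) →
    (∀ q : Polynomial ℂ, NZ Z q → ∀ x, Polynomial.aeval A q x ∈ M → x ∈ M) → M = ⊤

lemma NZ.one (Z : Set ℂ) : NZ Z 1 := by intro z _; simp
lemma NZ.mul {Z : Set ℂ} {p q : Polynomial ℂ} (hp : NZ Z p) (hq : NZ Z q) : NZ Z (p * q) := by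
  intro z hz; simpa using ⟨hp z hz, hq z hz⟩

lemma NZ.isUnit {Z : Set ℂ} {q : Polynomial ℂ} (hq : NZ Z q) (A : K →L[ℂ] K)
    (hZ : spectrum ℂ A ⊆ Z) : IsUnit (Polynomial.aeval A q) := by
  rcases subsingleton_or_nontrivial (K →L[ℂ] K) with h | h
  · exact isUnit_of_subsingleton _
  · rw [← spectrum.zero_notMem_iff ℂ, spectrum.map_polynomial_aeval]
    rintro ⟨z, hz, h0⟩
    exact hq z (hZ hz) h0

/-- vectors `q(A)⁻¹ ∑ pᵢ(A) wᵢ`. -/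
def ratSub (A : K →L[ℂ] K) {m : ℕ} (w : Fin m → K) (Z : Set ℂ) : Submodule ℂ K where
  carrier := {x | ∃ q : Polynomial ℂ, NZ Z q ∧ ∃ p : Fin m → Polynomial ℂ,
    Polynomial.aeval A q x = ∑ i, Polynomial.aeval A (p i) (w i)}
  zero_mem' := ⟨1, NZ.one Z, 0, by simp⟩
  add_mem' := by
    rintro x y ⟨q, hq, p, h⟩ ⟨q', hq', p', h'⟩
    refine ⟨q * q', hq.mul hq', fun i => q' * p i + q * p' i, ?_⟩
    rw [map_add]
    nth_rewrite 1 [mul_comm q q']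
    simp only [map_mul, mul_apply_eq_comp, h, h', map_add, _root_.add_apply, Finset.sum_add_distrib,
      map_sum]
  smul_mem' := by
    rintro c x ⟨q, hq, p, h⟩
    refine ⟨q, hq, fun i => c • p i, ?_⟩
    simp [h, Finset.smul_sum]

lemma ratSub_dense (A : K →L[ℂ] K) {m : ℕ} (w : Fin m → K) (Z : Set ℂ)
    (hZ : spectrum ℂ A ⊆ Z) (hc : RCyc A w Z) : (ratSub A w Z).topologicalClosure = ⊤ := by
  have aux : ∀ B : K →L[ℂ] K, (∀ x ∈ ratSub A w Z, B x ∈ ratSub A w Z) →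
      ∀ x ∈ (ratSub A w Z).topologicalClosure, B x ∈ (ratSub A w Z).topologicalClosure := by
    intro B hB x hx
    exact map_mem_closure B.continuous hx hB
  apply hc
  · exact Submodule.isClosed_topologicalClosure _
  · intro i
    apply Submodule.le_topologicalClosure
    refine ⟨1, NZ.one Z, Pi.single i 1, ?_⟩
    rw [Finset.sum_eq_single i]
    · simp
    · intro j _ hj; simp [Pi.single_eq_of_ne hj]
    · simp
  · apply aux
    rintro x ⟨q, hq, p, h⟩
    refine ⟨q, hq, fun i => Polynomial.X * p i, ?_⟩
    have : Polynomial.aeval A q (A x) = A (Polynomial.aeval A q x) := by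
      have : Polynomial.aeval A (q * Polynomial.X) = Polynomial.aeval A (Polynomial.X * q) := by
        rw [mul_comm]
      have := congrArg (fun B : K →L[ℂ] K => B x) this
      simpa using this
    rw [this, h, map_sum]
    simp
  · intro q hq x hx
    obtain ⟨u, hu⟩ := hq.isUnit A hZ
    have e : ∀ y, (↑u⁻¹ : K →L[ℂ] K) (Polynomial.aeval A q y) = y := by
      intro y
      rw [← hu, ← mul_apply_eq_comp, Units.inv_mul, one_apply_eq_self]
    have e' : ∀ y, (Polynomial.aeval A q) ((↑u⁻¹ : K →L[ℂ] K) y) = y := by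
      intro y
      rw [← hu, ← mul_apply_eq_comp, Units.mul_inv, one_apply_eq_self]
    rw [← e x]
    refine aux _ ?_ _ hx
    rintro y ⟨q', hq', p, h⟩
    refine ⟨q' * q, hq'.mul hq, p, ?_⟩
    rw [map_mul, mul_apply_eq_comp, e', h]

/-- Berger-Shaw, norm version. -/
lemma norm_bound (A : K →L[ℂ] K) (hA : ∀ x, 0 ≤ dfc A x) {m : ℕ} (w : Fin m → K) (Z : Set ℂ)
    (hZ : spectrum ℂ A ⊆ Z) (hc : RCyc A w Z) {ι : Type*} [Fintype ι] (f : ι → K)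
    (hf : Orthonormal ℂ f) : ∑ i, dfc A (f i) ≤ m * ‖A‖ ^ 2 := by
  by_contra! hlt
  have hcont : Continuous fun y : ι → K => ∑ i, dfc A (y i) := by
    have := dfc_continuous A
    fun_prop
  have hev := (hcont.tendsto f).eventually_const_lt hlt
  obtain ⟨δ, hδ, hball⟩ := Metric.eventually_nhds_iff.1 hev
  have hdense : ∀ i, ∃ x ∈ ratSub A w Z, dist (f i) x < δ := by
    intro i
    have : f i ∈ (ratSub A w Z).topologicalClosure := by rw [ratSub_dense A w Z hZ hc]; trivial
    exact Metric.mem_closure_iff.1 this δ hδ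
  choose x hx hxd using hdense
  choose q hq p hp using hx
  let qq : Polynomial ℂ := ∏ i, q i
  have hqq : NZ Z qq := by
    intro z hz
    simp only [qq, Polynomial.eval_prod]
    exact Finset.prod_ne_zero_iff.2 fun i _ => hq i z hz
  obtain ⟨u, hu⟩ := hqq.isUnit A hZ
  set R : K →L[ℂ] K := (↑u⁻¹ : K →L[ℂ] K) with hR
  have e : ∀ y, R (Polynomial.aeval A qq y) = y := by
    intro y
    rw [← hu, ← mul_apply_eq_comp, Units.inv_mul, one_apply_eq_self]
  have hRA : Commute R A := by
    have : Commute (↑u : K →L[ℂ] K) A := by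
      rw [hu]
      have := Polynomial.aeval_X (R := ℂ) A
      nth_rewrite 2 [← this]
      exact Commute.map (Commute.all _ _) (Polynomial.aeval A)
    exact this.units_inv_left
  classical
  have hdvd : ∀ i, ∃ s, qq = s * q i := fun i => by
    obtain ⟨s, hs⟩ := Finset.dvd_prod_of_mem q (Finset.mem_univ i)
    exact ⟨s, by rw [mul_comm]; exact hs⟩
  choose s hs using hdvd
  let N : ℕ := ∑ i, ∑ j, (s i * p i j).natDegree
  let F : Submodule ℂ K := Submodule.span ℂ
    (Set.range fun kj : Fin (N + 1) × Fin m => R ((A ^ (kj.1 : ℕ)) (w kj.2)))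
  have : FiniteDimensional ℂ F := FiniteDimensional.span_of_finite ℂ (Set.finite_range _)
  have hxF : ∀ i, x i ∈ F := by
    intro i
    rw [← e (x i), hs i, map_mul, mul_apply_eq_comp, hp, map_sum, map_sum]
    refine Submodule.sum_mem _ fun j _ => ?_
    rw [← mul_apply_eq_comp (Polynomial.aeval A (s i)), ← map_mul, Polynomial.aeval_eq_sum_range]
    rw [_root_.sum_apply, map_sum]
    refine Submodule.sum_mem _ fun k hk => ?_
    have hN : (s i * p i j).natDegree ≤ N := by
      refine le_trans ?_ (Finset.single_le_sum (f := fun i => ∑ j, (s i * p i j).natDegree)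
        (fun _ _ => Nat.zero_le _) (Finset.mem_univ i))
      exact (Finset.single_le_sum (f := fun j => (s i * p i j).natDegree)
        (fun _ _ => Nat.zero_le _) (Finset.mem_univ j))
    rw [_root_.smul_apply, map_smul]
    refine Submodule.smul_mem _ _ (Submodule.subset_span ⟨(⟨k, ?_⟩, j), rfl⟩)
    have := Finset.mem_range.1 hk
    omega
  have hAF : ∀ y ∈ F, A y ∈ F ⊔ Submodule.span ℂ (Set.range fun j => R ((A ^ (N + 1)) (w j))) := by
    have : F ≤ (F ⊔ Submodule.span ℂ (Set.range fun j => R ((A ^ (N + 1)) (w j)))).comap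
        A.toLinearMap := by
      refine Submodule.span_le.2 ?_
      rintro _ ⟨⟨k, j⟩, rfl⟩
      have h1 : A (R ((A ^ (k : ℕ)) (w j))) = R ((A ^ ((k : ℕ) + 1)) (w j)) := by
        rw [← mul_apply_eq_comp, ← hRA.eq, pow_succ', mul_apply_eq_comp, mul_apply_eq_comp]
      rw [SetLike.mem_coe, Submodule.mem_comap]
      change A (R ((A ^ (k : ℕ)) (w j))) ∈ _
      rw [h1]
      rcases Nat.lt_or_ge (k : ℕ) N with hk | hk
      · exact Submodule.mem_sup_left (Submodule.subset_span ⟨(⟨k + 1, by omega⟩, j), rfl⟩)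
      · have : (k : ℕ) = N := by omega
        rw [this]
        exact Submodule.mem_sup_right (Submodule.subset_span ⟨j, rfl⟩)
    exact this
  have hb := fin_bound A hA F _ hAF f hf
  refine absurd hb (not_le.2 (hball ?_))
  rw [dist_pi_lt_iff hδ]
  intro i
  rw [dist_comm, dist_eq_norm, Submodule.starProjection_minimal]
  refine lt_of_le_of_lt (ciInf_le ⟨0, ?_⟩ (⟨x i, hxF i⟩ : F)) ?_
  · rintro _ ⟨y, rfl⟩; exact norm_nonneg _
  · rw [← dist_eq_norm]; exact hxd i

section block
variable {L : Type*} [NormedAddCommGroup L] [InnerProductSpace ℂ L] [CompleteSpace L]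

/-- block diagonal operator. -/
def blkFun (A : K →L[ℂ] K) (B : L →L[ℂ] L) : WithLp 2 (K × L) →L[ℂ] WithLp 2 (K × L) :=
  ((WithLp.prodContinuousLinearEquiv 2 ℂ K L).symm : (K × L) →L[ℂ] WithLp 2 (K × L)) ∘L
    (A.prodMap B) ∘L (WithLp.prodContinuousLinearEquiv 2 ℂ K L : WithLp 2 (K × L) →L[ℂ] K × L)

lemma blkFun_apply (A : K →L[ℂ] K) (B : L →L[ℂ] L) (x : WithLp 2 (K × L)) :
    blkFun A B x = WithLp.toLp 2 (A x.fst, B x.snd) := rfl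

/-- block diagonal operators as an algebra homomorphism. -/
def blk : ((K →L[ℂ] K) × (L →L[ℂ] L)) →ₐ[ℂ] (WithLp 2 (K × L) →L[ℂ] WithLp 2 (K × L)) where
  toFun P := blkFun P.1 P.2
  map_one' := by ext x; all_goals rfl
  map_mul' P Q := by ext x; all_goals rfl
  map_zero' := by ext x; all_goals rfl
  map_add' P Q := by ext x; all_goals rfl
  commutes' c := by ext x; all_goals rfl

lemma blk_apply (A : K →L[ℂ] K) (B : L →L[ℂ] L) (x : WithLp 2 (K × L)) :
    blk (A, B) x = WithLp.toLp 2 (A x.fst, B x.snd) := rfl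

lemma blk_adjoint (A : K →L[ℂ] K) (B : L →L[ℂ] L) :
    adjoint (blk (A, B)) = blk (adjoint A, adjoint B) := by
  symm
  rw [ContinuousLinearMap.eq_adjoint_iff]
  intro x y
  simp only [blk_apply, WithLp.prod_inner_apply, ContinuousLinearMap.adjoint_inner_left,
    WithLp.fst, WithLp.snd]

lemma dfc_blk (A : K →L[ℂ] K) (B : L →L[ℂ] L) (x : WithLp 2 (K × L)) :
    dfc (blk (A, B)) x = dfc A x.fst + dfc B x.snd := by
  simp only [dfc, blk_adjoint, blk_apply, WithLp.prod_norm_sq_eq_of_L2, WithLp.fst, WithLp.snd]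
  ring

lemma norm_blk_le (A : K →L[ℂ] K) (B : L →L[ℂ] L) {R : ℝ} (hA : ‖A‖ ≤ R) (hB : ‖B‖ ≤ R) :
    ‖blk (A, B)‖ ≤ R := by
  have hR : 0 ≤ R := (norm_nonneg _).trans hA
  refine ContinuousLinearMap.opNorm_le_bound _ hR fun x => ?_
  refine le_of_sq_le_sq ?_ (by positivity)
  rw [mul_pow, WithLp.prod_norm_sq_eq_of_L2, WithLp.prod_norm_sq_eq_of_L2, mul_add]
  have h1 := A.le_of_opNorm_le hA x.fst
  have h2 := B.le_of_opNorm_le hB x.snd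
  rw [← mul_pow, ← mul_pow]
  gcongr
  · exact h1
  · exact h2

lemma spectrum_blk (A : K →L[ℂ] K) (B : L →L[ℂ] L) :
    spectrum ℂ (blk (A, B)) ⊆ spectrum ℂ A ∪ spectrum ℂ B := by
  intro z hz
  by_contra hn
  simp only [Set.mem_union, not_or, spectrum.notMem_iff] at hn
  refine (spectrum.notMem_iff.2 ?_) hz
  have h : IsUnit (algebraMap ℂ ((K →L[ℂ] K) × (L →L[ℂ] L)) z - (A, B)) :=
    Prod.isUnit_iff.2 hn
  have := h.map (blk (K := K) (L := L))
  rwa [map_sub, AlgHom.commutes] at this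

lemma aeval_blk (A : K →L[ℂ] K) (B : L →L[ℂ] L) (q : Polynomial ℂ) :
    Polynomial.aeval (blk (A, B)) q = blk (Polynomial.aeval A q, Polynomial.aeval B q) := by
  rw [Polynomial.aeval_algHom_apply, Polynomial.aeval_prod_apply]

lemma pow_tendsto_zero (V : K →L[ℂ] K) (hV : ∀ z ∈ spectrum ℂ V, ‖z‖ < 1) :
    Filter.Tendsto (fun n : ℕ => V ^ n) Filter.atTop (nhds 0) := by
  rcases subsingleton_or_nontrivial (K →L[ℂ] K) with h | h
  · have : (fun n : ℕ => V ^ n) = fun _ => 0 := Subsingleton.elim _ _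
    rw [this]; exact tendsto_const_nhds
  have h1 : spectralRadius ℂ V < (1 : ℝ≥0) :=
    spectrum.spectralRadius_lt_of_forall_lt V fun z hz => by
      have := hV z hz
      exact_mod_cast this
  obtain ⟨t, ht1, ht2⟩ := ENNReal.lt_iff_exists_nnreal_btwn.1 h1
  have h2 := spectrum.pow_nnnorm_pow_one_div_tendsto_nhds_spectralRadius V
  have h3 := h2.eventually_lt_const ht1
  have ht : t < 1 := by exact_mod_cast ht2
  have h4 : ∀ᶠ n : ℕ in Filter.atTop, ‖V ^ n‖ ≤ (t : ℝ) ^ n := by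
    filter_upwards [h3, Filter.eventually_gt_atTop 0] with n hn hn0
    have hn' : (n : ℝ) ≠ 0 := by positivity
    have h5 := ENNReal.rpow_le_rpow hn.le (z := (n : ℝ)) (by positivity)
    rw [← ENNReal.rpow_mul, one_div_mul_cancel hn', ENNReal.rpow_one, ENNReal.rpow_natCast] at h5
    have : ‖V ^ n‖₊ ≤ t ^ n := by exact_mod_cast h5
    exact_mod_cast this
  exact squeeze_zero_norm' h4 (tendsto_pow_atTop_nhds_zero_of_lt_one t.2 (by exact_mod_cast ht))

lemma inv_tendsto_one (V : ℕ → (K →L[ℂ] K)) (hV : Filter.Tendsto V Filter.atTop (nhds 0)) :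
    Filter.Tendsto (fun n => Ring.inverse (1 - V n)) Filter.atTop (nhds 1) := by
  have h1 : Filter.Tendsto (fun n => 1 - V n) Filter.atTop (nhds ((1 : (K →L[ℂ] K)ˣ) : K →L[ℂ] K)) := by
    simpa using hV.const_sub 1
  have := (NormedRing.inverse_continuousAt (1 : (K →L[ℂ] K)ˣ)).tendsto.comp h1
  simpa [Function.comp_def] using this

/-- The polynomial `1 - ((z-a)/ρ)^n`. -/
def sepPoly (a : ℂ) (ρ : ℝ) (n : ℕ) : Polynomial ℂ :=
  1 - (Polynomial.C ((ρ : ℂ)⁻¹) * (Polynomial.X - Polynomial.C a)) ^ n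

lemma aeval_sepPoly (A : K →L[ℂ] K) (a : ℂ) (ρ : ℝ) (n : ℕ) :
    Polynomial.aeval A (sepPoly a ρ n) =
      1 - ((ρ : ℂ)⁻¹ • (A - algebraMap ℂ (K →L[ℂ] K) a)) ^ n := by
  simp only [sepPoly, map_sub, map_one, map_pow, map_mul, Polynomial.aeval_C, Polynomial.aeval_X]
  rw [Algebra.smul_def]

lemma sepPoly_NZ (Z : Set ℂ) (a : ℂ) {ρ : ℝ} (hρ : 0 < ρ) (hZ : ∀ z ∈ Z, ‖z - a‖ ≠ ρ) {n : ℕ}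
    (hn : n ≠ 0) : NZ Z (sepPoly a ρ n) := by
  intro z hz h0
  simp only [sepPoly, Polynomial.eval_sub, Polynomial.eval_one, Polynomial.eval_pow,
    Polynomial.eval_mul, Polynomial.eval_C, Polynomial.eval_X] at h0
  have h1 : ((ρ : ℂ)⁻¹ * (z - a)) ^ n = 1 := (sub_eq_zero.1 h0).symm
  have h2 := congrArg norm h1
  rw [norm_pow, norm_one] at h2
  have h3 := (pow_eq_one_iff_of_nonneg (norm_nonneg _) hn).1 h2
  rw [norm_mul, norm_inv, Complex.norm_real, Real.norm_of_nonneg hρ.le] at h3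
  apply hZ z hz
  field_simp at h3
  exact h3

lemma sep_tendsto_one (B : K →L[ℂ] K) (a : ℂ) {r ρ : ℝ} (hr : r < ρ) (hρ : 0 < ρ)
    (hB : ‖B - algebraMap ℂ (K →L[ℂ] K) a‖ ≤ r) :
    Filter.Tendsto (fun n => Ring.inverse (Polynomial.aeval B (sepPoly a ρ n))) Filter.atTop
      (nhds 1) := by
  simp only [aeval_sepPoly]
  apply inv_tendsto_one
  apply tendsto_pow_atTop_nhds_zero_of_norm_lt_one
  rw [norm_smul, norm_inv, Complex.norm_real, Real.norm_of_nonneg hρ.le, inv_mul_lt_iff₀ hρ]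
  linarith

lemma sep_tendsto_zero (A : K →L[ℂ] K) (a : ℂ) {ρ : ℝ} (hρ : 0 < ρ)
    (hA : ∀ z ∈ spectrum ℂ A, ρ < ‖z - a‖) :
    Filter.Tendsto (fun n => Ring.inverse (Polynomial.aeval A (sepPoly a ρ n))) Filter.atTop
      (nhds 0) := by
  simp only [aeval_sepPoly]
  have hρ' : (ρ : ℂ)⁻¹ ≠ 0 := by simpa using hρ.ne'
  have hsp : ∀ z ∈ spectrum ℂ ((ρ : ℂ)⁻¹ • (A - algebraMap ℂ (K →L[ℂ] K) a)), 1 < ‖z‖ := by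
    intro z hz
    have e : Polynomial.aeval A (Polynomial.C ((ρ : ℂ)⁻¹) * (Polynomial.X - Polynomial.C a)) =
        (ρ : ℂ)⁻¹ • (A - algebraMap ℂ (K →L[ℂ] K) a) := by
      simp only [map_sub, map_mul, Polynomial.aeval_C, Polynomial.aeval_X]
      rw [Algebra.smul_def]
    rcases subsingleton_or_nontrivial (K →L[ℂ] K) with h | h
    · exact absurd (isUnit_of_subsingleton _) (spectrum.mem_iff.1 hz)
    rw [← e, spectrum.map_polynomial_aeval] at hz
    obtain ⟨y, hy, rfl⟩ := hz
    simp only [Polynomial.eval_sub, Polynomial.eval_mul, Polynomial.eval_C, Polynomial.eval_X,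
      norm_mul, norm_inv, Complex.norm_real, Real.norm_of_nonneg hρ.le]
    rw [lt_inv_mul_iff₀ hρ]
    simpa using hA y hy
  set X := (ρ : ℂ)⁻¹ • (A - algebraMap ℂ (K →L[ℂ] K) a) with hX
  have hu : IsUnit X := by
    rw [← spectrum.zero_notMem_iff ℂ]
    intro h0
    have := hsp 0 h0
    simp at this
    linarith
  obtain ⟨u, hu⟩ := hu
  have hV := pow_tendsto_zero (↑u⁻¹ : K →L[ℂ] K) (by
    intro z hz
    have hz0 : z ≠ 0 := by
      rintro rfl
      exact (spectrum.zero_notMem_iff ℂ).2 (Units.isUnit u⁻¹) hz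
    have : z⁻¹ ∈ spectrum ℂ X := by
      have := spectrum.inv_mem_iff (r := Units.mk0 z hz0) (a := u⁻¹)
      rw [← hu]
      simpa using this.1 hz
    have := hsp _ this
    rw [norm_inv] at this
    exact (one_lt_inv₀ (norm_pos_iff.2 hz0)).1 this)
  have e : ∀ n, Ring.inverse (1 - X ^ n) =
      - (Ring.inverse (1 - (↑u⁻¹ : K →L[ℂ] K) ^ n) * (↑u⁻¹ : K →L[ℂ] K) ^ n) := by
    intro n
    have h1 : (1 - X ^ n) = (-(↑(u ^ n) : K →L[ℂ] K)) * (1 - (↑u⁻¹ : K →L[ℂ] K) ^ n) := by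
      rw [← hu, mul_sub, ← Units.val_pow_eq_pow_val, ← Units.val_pow_eq_pow_val, neg_mul, neg_mul,
        ← Units.val_mul, inv_pow, mul_inv_cancel]
      rw [Units.val_one, mul_one, sub_neg_eq_add, neg_add_eq_sub]
    have h2 : (-(↑(u ^ n) : K →L[ℂ] K)) = ((-(u ^ n) : (K →L[ℂ] K)ˣ) : K →L[ℂ] K) := by simp
    rw [h1, h2, Ring.inverse_mul (Or.inl (Units.isUnit _)), Ring.inverse_unit, inv_neg,
      Units.val_neg, mul_neg, ← inv_pow, Units.val_pow_eq_pow_val]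
  simp only [e]
  simpa using ((inv_tendsto_one _ hV).mul hV).neg

end block
section step
variable {L : Type*} [NormedAddCommGroup L] [InnerProductSpace ℂ L] [CompleteSpace L]

lemma RCyc_blk (A : K →L[ℂ] K) (B : L →L[ℂ] L) {m : ℕ} (w : Fin m → K) (v : Fin m → L)
    (Z : Set ℂ) (hAZ : spectrum ℂ A ⊆ Z) (hBZ : spectrum ℂ B ⊆ Z) (a : ℂ) {r ρ : ℝ}
    (hr : r < ρ) (hρ : 0 < ρ) (hB : ‖B - algebraMap ℂ (L →L[ℂ] L) a‖ ≤ r)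
    (hA : ∀ z ∈ spectrum ℂ A, ρ < ‖z - a‖) (hZ : ∀ z ∈ Z, ‖z - a‖ ≠ ρ)
    (hcA : RCyc A w Z) (hcB : RCyc B v Z) :
    RCyc (blk (A, B)) (fun i => WithLp.toLp 2 (w i, v i)) Z := by
  intro M hMc hw hMA hMq
  have hsnd : ∀ x1 x2, WithLp.toLp 2 (x1, x2) ∈ M → WithLp.toLp 2 ((0 : K), x2) ∈ M := by
    intro x1 x2 hx
    have t1 := sep_tendsto_zero A a hρ hA
    have t2 := sep_tendsto_one B a hr hρ hB
    have t1' := ((ContinuousLinearMap.apply ℂ K x1).continuous.tendsto _).comp t1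
    have t2' := ((ContinuousLinearMap.apply ℂ L x2).continuous.tendsto _).comp t2
    have t3 := ((WithLp.prodContinuousLinearEquiv 2 ℂ K L).symm.continuous.tendsto _).comp
      (t1'.prodMk_nhds t2')
    refine hMc.mem_of_tendsto t3 ?_
    filter_upwards [Filter.eventually_ne_atTop 0] with n hn
    have hq := sepPoly_NZ Z a hρ hZ hn
    apply hMq _ hq
    rw [aeval_blk, blk_apply]
    have e1 : Polynomial.aeval A (sepPoly a ρ n)
        (Ring.inverse (Polynomial.aeval A (sepPoly a ρ n)) x1) = x1 := by
      rw [← mul_apply_eq_comp, Ring.mul_inverse_cancel _ (hq.isUnit A hAZ), one_apply_eq_self]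
    have e2 : Polynomial.aeval B (sepPoly a ρ n)
        (Ring.inverse (Polynomial.aeval B (sepPoly a ρ n)) x2) = x2 := by
      rw [← mul_apply_eq_comp, Ring.mul_inverse_cancel _ (hq.isUnit B hBZ), one_apply_eq_self]
    convert hx using 1
    exact congrArg (WithLp.toLp 2) (Prod.ext e1 e2)
  have hfst : ∀ x1 x2, WithLp.toLp 2 (x1, x2) ∈ M → WithLp.toLp 2 (x1, (0 : L)) ∈ M := by
    intro x1 x2 hx
    have := M.sub_mem hx (hsnd x1 x2 hx)
    convert this using 1
    rw [← WithLp.toLp_sub]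
    simp
  let J1 : K →L[ℂ] WithLp 2 (K × L) :=
    ((WithLp.prodContinuousLinearEquiv 2 ℂ K L).symm : (K × L) →L[ℂ] WithLp 2 (K × L)) ∘L
      ContinuousLinearMap.inl ℂ K L
  let J2 : L →L[ℂ] WithLp 2 (K × L) :=
    ((WithLp.prodContinuousLinearEquiv 2 ℂ K L).symm : (K × L) →L[ℂ] WithLp 2 (K × L)) ∘L
      ContinuousLinearMap.inr ℂ K L
  have hJ1 : ∀ (X : K →L[ℂ] K) (Y : L →L[ℂ] L) x, blk (X, Y) (J1 x) = J1 (X x) := by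
    intro X Y x
    rw [blk_apply]
    exact congrArg (WithLp.toLp 2) (Prod.ext rfl (map_zero Y))
  have hJ2 : ∀ (X : K →L[ℂ] K) (Y : L →L[ℂ] L) x, blk (X, Y) (J2 x) = J2 (Y x) := by
    intro X Y x
    rw [blk_apply]
    exact congrArg (WithLp.toLp 2) (Prod.ext (map_zero X) rfl)
  have h1 : M.comap J1.toLinearMap = ⊤ := by
    apply hcA
    · exact hMc.preimage J1.continuous
    · intro i; exact hfst _ _ (hw i)
    · intro x hx
      have := hMA (J1 x) hx
      rw [hJ1] at this
      exact this
    · intro q hq x hx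
      apply hMq q hq (J1 x)
      rw [aeval_blk, hJ1]
      exact hx
  have h2 : M.comap J2.toLinearMap = ⊤ := by
    apply hcB
    · exact hMc.preimage J2.continuous
    · intro i; exact hsnd _ _ (hw i)
    · intro x hx
      have := hMA (J2 x) hx
      rw [hJ2] at this
      exact this
    · intro q hq x hx
      apply hMq q hq (J2 x)
      rw [aeval_blk, hJ2]
      exact hx
  rw [eq_top_iff]
  intro x _
  have m1 : J1 x.fst ∈ M := (h1 ▸ Submodule.mem_top : x.fst ∈ M.comap J1.toLinearMap)
  have m2 : J2 x.snd ∈ M := (h2 ▸ Submodule.mem_top : x.snd ∈ M.comap J2.toLinearMap)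
  have := M.add_mem m1 m2
  convert this using 1
  apply (WithLp.prodContinuousLinearEquiv 2 ℂ K L).injective
  apply Prod.ext <;> simp [J1, J2]

end step

/-- The Hilbert space on which the shift model lives. -/
abbrev ShSp (m : ℕ) : Type := lp (fun _ : Fin m × ℕ => ℂ) 2

lemma exists_shift (m : ℕ) : ∃ (b : HilbertBasis (Fin m × ℕ) ℂ (ShSp m))
    (S : ShSp m →L[ℂ] ShSp m), (∀ x, ‖S x‖ = ‖x‖) ∧ ∀ i n, S (b (i, n)) = b (i, n + 1) := by
  classical
  let b : HilbertBasis (Fin m × ℕ) ℂ (ShSp m) := ⟨LinearIsometryEquiv.refl ℂ _⟩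
  have hv : Orthonormal ℂ (fun k : Fin m × ℕ => b (k.1, k.2 + 1)) := by
    refine b.orthonormal.comp _ ?_
    rintro ⟨i, n⟩ ⟨j, k⟩ h
    simpa using h
  have hb : ∀ k, b k = lp.single 2 k (1 : ℂ) := fun k => (b.repr_symm_single k).symm
  let S := hv.orthogonalFamily.linearIsometry
  refine ⟨b, S.toContinuousLinearMap, fun x => S.norm_map x, fun i n => ?_⟩
  rw [hb (i, n)]
  have := hv.orthogonalFamily.linearIsometry_apply_single (i := (i, n)) (1 : ℂ)
  exact this.trans (by simp)

lemma dfc_affine (S : K →L[ℂ] K) (a : ℂ) (r : ℝ) (x : K) :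
    dfc (algebraMap ℂ (K →L[ℂ] K) a + (r : ℂ) • S) x = r ^ 2 * dfc S x := by
  have had : adjoint (algebraMap ℂ (K →L[ℂ] K) a + (r : ℂ) • S) =
      (starRingEnd ℂ a) • (1 : K →L[ℂ] K) + (r : ℂ) • adjoint S := by
    symm
    rw [ContinuousLinearMap.eq_adjoint_iff]
    intro x y
    simp [Algebra.algebraMap_eq_smul_one, inner_add_left, inner_add_right, inner_smul_left,
      inner_smul_right, ContinuousLinearMap.adjoint_inner_left]
  simp only [dfc, had]
  simp only [Algebra.algebraMap_eq_smul_one, _root_.add_apply, _root_.smul_apply,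
    one_apply_eq_self]
  rw [norm_add_sq (𝕜 := ℂ), norm_add_sq (𝕜 := ℂ)]
  have : RCLike.re (inner ℂ (a • x) ((r : ℂ) • S x)) =
      RCLike.re (inner ℂ (starRingEnd ℂ a • x) ((r : ℂ) • adjoint S x)) := by
    rw [inner_smul_left, inner_smul_right, inner_smul_left, inner_smul_right,
      ContinuousLinearMap.adjoint_inner_right, ← inner_conj_symm (S x) x, ← RCLike.conj_re]
    simp only [map_mul, Complex.conj_conj, Complex.conj_ofReal]
  rw [this]
  simp only [norm_smul, Complex.norm_real, mul_pow, RCLike.norm_conj, Real.norm_eq_abs, sq_abs]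
  ring

lemma exists_disc_op (m : ℕ) (a : ℂ) {r : ℝ} (hr : 0 < r) :
    ∃ (B : ShSp m →L[ℂ] ShSp m) (v : Fin m → ShSp m),
      Orthonormal ℂ v ∧ ‖B - algebraMap ℂ _ a‖ ≤ r ∧ (∀ x, 0 ≤ dfc B x) ∧
      (∀ i, dfc B (v i) = r ^ 2) ∧ ∀ Z, RCyc B v Z := by
  obtain ⟨b, S, hS, hSb⟩ := exists_shift m
  have hSn : ‖S‖ ≤ 1 := S.opNorm_le_bound zero_le_one fun x => by rw [hS, one_mul]
  refine ⟨algebraMap ℂ _ a + (r : ℂ) • S, fun i => b (i, 0), ?_, ?_, ?_, ?_, ?_⟩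
  · exact b.orthonormal.comp _ fun i j h => by simpa using h
  · rw [add_sub_cancel_left, norm_smul, Complex.norm_real, Real.norm_of_nonneg hr.le]
    exact mul_le_of_le_one_right hr.le hSn
  · intro x
    rw [dfc_affine]
    refine mul_nonneg (by positivity) (sub_nonneg.2 ?_)
    rw [hS]
    gcongr
    refine (ContinuousLinearMap.le_of_opNorm_le _ (c := 1) ?_ x).trans (by rw [one_mul])
    rw [LinearIsometryEquiv.norm_map]; exact hSn
  · intro i
    rw [dfc_affine, dfc, hS]
    have h0 : adjoint S (b (i, 0)) = 0 := by
      have hd : Dense ((Submodule.span ℂ (Set.range b) : Submodule ℂ _) : Set (ShSp m)) :=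
        Submodule.dense_iff_topologicalClosure_eq_top.2 b.dense_span
      refine hd.eq_zero_of_inner_left (𝕜 := ℂ) ?_
      intro y hy
      rw [SetLike.mem_coe] at hy
      rw [ContinuousLinearMap.adjoint_inner_left]
      induction hy using Submodule.span_induction with
      | mem x hx =>
        obtain ⟨⟨j, n⟩, rfl⟩ := hx
        rw [hSb]
        exact b.orthonormal.2 (by simp)
      | zero => simp
      | add x y _ _ hx hy => simp [inner_add_right, hx, hy]
      | smul c x _ hx => simp [inner_smul_right, hx]
    rw [h0, b.orthonormal.1]
    simp
  · intro Z M hMc hw hMA _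
    have hrc : (r : ℂ) ≠ 0 := by exact_mod_cast hr.ne'
    have hMS : ∀ x ∈ M, S x ∈ M := by
      intro x hx
      have h1 := M.sub_mem (hMA x hx) (M.smul_mem a hx)
      have h2 := M.smul_mem ((r : ℂ)⁻¹) h1
      have : ((r : ℂ)⁻¹) • ((algebraMap ℂ (ShSp m →L[ℂ] ShSp m) a + (r : ℂ) • S) x - a • x) = S x := by
        rw [_root_.add_apply, Algebra.algebraMap_eq_smul_one, _root_.smul_apply, _root_.smul_apply,
          one_apply_eq_self, add_sub_cancel_left, smul_smul, inv_mul_cancel₀ hrc, one_smul]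
      rwa [this] at h2
    have hall : ∀ i n, b (i, n) ∈ M := by
      intro i n
      induction n with
      | zero => exact hw i
      | succ n ih => rw [← hSb]; exact hMS _ ih
    rw [eq_top_iff, ← b.dense_span]
    refine Submodule.topologicalClosure_minimal _ (Submodule.span_le.2 ?_) hMc
    rintro _ ⟨⟨i, n⟩, rfl⟩
    exact hall i n


universe u

lemma norm_disc (B : K →L[ℂ] K) (a : ℂ) {r : ℝ} (hB : ‖B - algebraMap ℂ (K →L[ℂ] K) a‖ ≤ r) :
    ‖B‖ ≤ ‖a‖ + r := by
  have h1 : B = (B - algebraMap ℂ _ a) + a • (1 : K →L[ℂ] K) := by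
    rw [← Algebra.algebraMap_eq_smul_one, sub_add_cancel]
  have h3 : ‖(1 : K →L[ℂ] K)‖ ≤ 1 := ContinuousLinearMap.norm_id_le
  have h2 : ‖a • (1 : K →L[ℂ] K)‖ ≤ ‖a‖ := by
    rw [norm_smul]
    exact mul_le_of_le_one_right (norm_nonneg _) h3
  have := norm_add_le (B - algebraMap ℂ _ a) (a • (1 : K →L[ℂ] K))
  rw [← h1] at this
  linarith

lemma spec_disc (B : K →L[ℂ] K) (a : ℂ) {r : ℝ} (hB : ‖B - algebraMap ℂ (K →L[ℂ] K) a‖ ≤ r) :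
    spectrum ℂ B ⊆ Metric.closedBall a r := by
  intro z hz
  have h1 : z - a ∈ spectrum ℂ (B - algebraMap ℂ _ a) := by
    rw [spectrum.mem_iff] at hz ⊢
    rwa [map_sub, sub_sub_sub_cancel_right]
  have h2 := spectrum.norm_le_norm_mul_of_mem h1
  rw [Metric.mem_closedBall, dist_eq_norm]
  refine h2.trans ?_
  have : ‖(1 : K →L[ℂ] K)‖ ≤ 1 := ContinuousLinearMap.norm_id_le
  exact (mul_le_of_le_one_right (norm_nonneg _) this).trans hB

section orth
variable {L : Type*} [NormedAddCommGroup L] [InnerProductSpace ℂ L] [CompleteSpace L]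

lemma orth_sum {n m : ℕ} (f : Fin n → K) (v : Fin m → L) (hf : Orthonormal ℂ f)
    (hv : Orthonormal ℂ v) :
    Orthonormal ℂ (Sum.elim (fun i => WithLp.toLp 2 (f i, 0)) (fun i => WithLp.toLp 2 (0, v i)) :
      Fin n ⊕ Fin m → WithLp 2 (K × L)) := by
  classical
  rw [orthonormal_iff_ite] at hf hv ⊢
  rintro (i | i) (j | j) <;> simp [WithLp.prod_inner_apply, hf, hv]

lemma dfc_sum {n m : ℕ} (A : K →L[ℂ] K) (B : L →L[ℂ] L) (f : Fin n → K) (v : Fin m → L) :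
    ∑ i, dfc (blk (A, B)) (((Sum.elim (fun i => WithLp.toLp 2 (f i, 0))
      (fun i => WithLp.toLp 2 (0, v i)) : Fin n ⊕ Fin m → WithLp 2 (K × L)) ∘
        finSumFinEquiv.symm) i) = ∑ i, dfc A (f i) + ∑ i, dfc B (v i) := by
  have hA0 : dfc A 0 = 0 := by simp [dfc]
  have hB0 : dfc B 0 = 0 := by simp [dfc]
  simp only [Function.comp_apply]
  rw [Equiv.sum_comp finSumFinEquiv.symm (fun i => dfc (blk (A, B)) (Sum.elim
    (fun i => WithLp.toLp 2 (f i, 0)) (fun i => WithLp.toLp 2 (0, v i)) i)), Fintype.sum_sum_type]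
  simp [dfc_blk, hA0, hB0]

end orth

/-- Berger-Shaw with finitely many discs removed. Discs are given as `(a, r, ρ)`. -/
lemma disc_bound {m : ℕ} (Z : Set ℂ) (R : ℝ) (l : List (ℂ × ℝ × ℝ)) :
    ∀ (K : Type u) [NormedAddCommGroup K] [InnerProductSpace ℂ K] [CompleteSpace K]
      (A : K →L[ℂ] K) (_ : ∀ x, 0 ≤ dfc A x) (w : Fin m → K) (_ : spectrum ℂ A ⊆ Z)
      (_ : RCyc A w Z) (_ : ‖A‖ ≤ R)
      (_ : ∀ D ∈ l, 0 < D.2.1 ∧ D.2.1 < D.2.2 ∧ ‖D.1‖ + D.2.1 ≤ R ∧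
        Metric.closedBall D.1 D.2.1 ⊆ Z ∧ (∀ z ∈ Z, ‖z - D.1‖ ≠ D.2.2) ∧
        Disjoint (spectrum ℂ A) (Metric.closedBall D.1 D.2.2))
      (_ : l.Pairwise fun D E => Disjoint (Metric.closedBall D.1 D.2.2) (Metric.closedBall E.1 E.2.2))
      (n : ℕ) (f : Fin n → K) (_ : Orthonormal ℂ f),
      ∑ i, dfc A (f i) + m * (l.map fun D => D.2.1 ^ 2).sum ≤ m * R ^ 2 := by
  induction l with
  | nil =>
    intro K _ _ _ A hA w hZ hc hR _ _ n f hf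
    have := norm_bound A hA w Z hZ hc f hf
    simp only [List.map_nil, List.sum_nil, mul_zero, add_zero]
    refine this.trans ?_
    gcongr
  | cons D l ih =>
    intro K _ _ _ A hA w hZ hc hR hD hl n f hf
    obtain ⟨a, r, ρ⟩ := D
    obtain ⟨hr, hrρ, haR, hDZ, hZρ, hdis⟩ := hD _ List.mem_cons_self
    simp only at hr hrρ haR hDZ hZρ hdis
    obtain ⟨B, v, hv, hBn, hBp, hBv, hBc⟩ := exists_disc_op m a hr
    have hspB : spectrum ℂ B ⊆ Metric.closedBall a r := spec_disc B a hBn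
    have hBR : ‖B‖ ≤ R := (norm_disc B a hBn).trans haR
    have hρ : 0 < ρ := hr.trans hrρ
    have hsp := spectrum_blk A B
    have hc' := RCyc_blk A B w v Z hZ (hspB.trans hDZ) a hrρ hρ hBn (by
      intro z hz
      by_contra! hle
      exact Set.disjoint_left.1 hdis hz (by rwa [Metric.mem_closedBall, dist_eq_norm])) hZρ hc
      (hBc Z)
    obtain ⟨hl1, hl2⟩ := List.pairwise_cons.1 hl
    let g : Fin n ⊕ Fin m → WithLp 2 (K × ShSp m) :=
      Sum.elim (fun i => WithLp.toLp 2 (f i, 0)) (fun i => WithLp.toLp 2 (0, v i))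
    have hg : Orthonormal ℂ g := orth_sum f v hf hv
    have hg' : Orthonormal ℂ (g ∘ finSumFinEquiv.symm) :=
      hg.comp _ finSumFinEquiv.symm.injective
    have key := ih (WithLp 2 (K × ShSp m)) (blk (A, B))
      (fun x => by rw [dfc_blk]; exact add_nonneg (hA _) (hBp _))
      (fun i => WithLp.toLp 2 (w i, v i))
      (hsp.trans (Set.union_subset hZ (hspB.trans hDZ))) hc' (norm_blk_le A B hR hBR)
      (by
        intro E hE
        obtain ⟨h1, h2, h3, h4, h5, h6⟩ := hD E (List.mem_cons_of_mem _ hE)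
        refine ⟨h1, h2, h3, h4, h5, ?_⟩
        refine Disjoint.mono_left hsp (Disjoint.union_left h6 ?_)
        refine Disjoint.mono_left (hspB.trans ?_) (hl1 E hE)
        exact Metric.closedBall_subset_closedBall hrρ.le)
      hl2 _ _ hg'
    have hsum : ∑ i, dfc (blk (A, B)) ((g ∘ finSumFinEquiv.symm) i) =
        ∑ i, dfc A (f i) + ∑ i, dfc B (v i) := dfc_sum A B f v
    simp only [hBv, Finset.sum_const, Finset.card_univ, Fintype.card_fin, nsmul_eq_mul] at hsum
    rw [hsum] at key
    simp only [List.map_cons, List.sum_cons]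
    linarith


lemma RCyc_of_dense (A : H →L[ℂ] H) {m : ℕ} (w : Fin m → H)
    (hd : Dense ((Submodule.span ℂ {x | ∃ v ∈ Set.range w, ∃ n : ℕ, x = (A ^ n) v} :
      Submodule ℂ H) : Set H)) (Z : Set ℂ) : RCyc A w Z := by
  intro M hM hw hA _
  have hsub : Submodule.span ℂ {x | ∃ v ∈ Set.range w, ∃ n : ℕ, x = (A ^ n) v} ≤ M := by
    rw [Submodule.span_le]
    rintro x ⟨v, ⟨i, rfl⟩, n, rfl⟩
    induction n with
    | zero => simpa using hw i
    | succ n ih =>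
      rw [pow_succ', mul_apply_eq_comp]
      exact hA _ ih
  have h2 : Dense (M : Set H) := hd.mono hsub
  rw [← SetLike.coe_set_eq, Submodule.top_coe, ← hM.closure_eq, h2.closure_eq]

/-- Finite disjoint families of discs off the spectrum. -/
lemma finset_bound (A : H →L[ℂ] H) (hA : ∀ x, 0 ≤ dfc A x) {m : ℕ} (w : Fin m → H)
    (hc : ∀ Z, RCyc A w Z) (R : ℝ) (hR : ‖A‖ ≤ R) (u : Finset ℂ) (ρ : ℂ → ℝ)
    (hρ : ∀ x ∈ u, 0 < ρ x ∧ ‖x‖ + ρ x ≤ R ∧ Disjoint (spectrum ℂ A) (Metric.closedBall x (ρ x)))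
    (hdis : ∀ x ∈ u, ∀ y ∈ u, x ≠ y →
      Disjoint (Metric.closedBall x (ρ x)) (Metric.closedBall y (ρ y)))
    {n : ℕ} (f : Fin n → H) (hf : Orthonormal ℂ f) :
    ∑ i, dfc A (f i) + m * ∑ x ∈ u, ρ x ^ 2 ≤ m * R ^ 2 := by
  have main : ∀ t : ℝ, 0 < t → t < 1 →
      ∑ i, dfc A (f i) + m * ∑ x ∈ u, (t * ρ x) ^ 2 ≤ m * R ^ 2 := by
    intro t ht0 ht1
    let Z : Set ℂ := spectrum ℂ A ∪ ⋃ x ∈ u, Metric.closedBall x (t * ρ x)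
    have hlt : ∀ x ∈ u, t * ρ x < ρ x := fun x hx => by nlinarith [(hρ x hx).1]
    have key := disc_bound Z R (u.toList.map fun x => (x, t * ρ x, ρ x)) H A hA w
      Set.subset_union_left (hc Z) hR (by
        intro D hD
        obtain ⟨x, hx, rfl⟩ := List.mem_map.1 hD
        rw [Finset.mem_toList] at hx
        obtain ⟨h1, h2, h3⟩ := hρ x hx
        refine ⟨mul_pos ht0 h1, hlt x hx, by linarith [hlt x hx], ?_, ?_, h3⟩
        · exact (Set.subset_biUnion_of_mem (u := fun x => Metric.closedBall x (t * ρ x))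
            (show x ∈ (u : Set ℂ) from hx)).trans Set.subset_union_right
        · rintro z (hz | hz) heq
          · refine Set.disjoint_left.1 h3 hz ?_
            rw [Metric.mem_closedBall, dist_eq_norm]
            exact heq.le
          · simp only [Set.mem_iUnion] at hz
            obtain ⟨y, hy, hz⟩ := hz
            by_cases hxy : y = x
            · subst hxy
              rw [Metric.mem_closedBall, dist_eq_norm] at hz
              simp only at heq
              linarith [hlt y hx]
            · refine Set.disjoint_left.1 (hdis y hy x hx hxy)
                (Metric.closedBall_subset_closedBall (hlt y hy).le hz) ?_
              rw [Metric.mem_closedBall, dist_eq_norm]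
              exact heq.le)
      (by
        rw [List.pairwise_map]
        refine List.Pairwise.imp_of_mem ?_ u.nodup_toList
        intro x y hx hy hxy
        exact hdis x (Finset.mem_toList.1 hx) y (Finset.mem_toList.1 hy) hxy) n f hf
    rw [List.map_map] at key
    have e : (List.map ((fun D : ℂ × ℝ × ℝ => D.2.1 ^ 2) ∘ fun x => (x, t * ρ x, ρ x)) u.toList).sum
        = ∑ x ∈ u, (t * ρ x) ^ 2 := by
      rw [← Finset.sum_map_toList]; rfl
    rw [e] at key
    exact key
  have hcont : Continuous fun t : ℝ => ∑ i, dfc A (f i) + m * ∑ x ∈ u, (t * ρ x) ^ 2 := by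
    fun_prop
  have hlim : Filter.Tendsto (fun t : ℝ => ∑ i, dfc A (f i) + m * ∑ x ∈ u, (t * ρ x) ^ 2)
      (nhdsWithin 1 (Set.Iio 1)) (nhds (∑ i, dfc A (f i) + m * ∑ x ∈ u, (1 * ρ x) ^ 2)) :=
    (hcont.tendsto 1).mono_left nhdsWithin_le_nhds
  have := le_of_tendsto hlim (b := m * R ^ 2) (by
    filter_upwards [Ioo_mem_nhdsLT (show (0:ℝ) < 1 by norm_num)] with t ht
    exact main t ht.1 ht.2)
  simpa using this

/-- The Berger-Shaw theorem. -/
lemma berger_shaw (A : H →L[ℂ] H) (hA : ∀ x, 0 ≤ dfc A x) {m : ℕ} (w : Fin m → H)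
    (hc : ∀ Z, RCyc A w Z) {n : ℕ} (f : Fin n → H) (hf : Orthonormal ℂ f) :
    ENNReal.ofReal (∑ i, dfc A (f i)) ≤
      (m : ℝ≥0∞) / ENNReal.ofReal Real.pi * volume (spectrum ℂ A) := by
  set R : ℝ := ‖A‖ + 1 with hRdef
  have hR : ‖A‖ ≤ R := by linarith
  have hR0 : 0 ≤ R := (norm_nonneg _).trans hR
  have hcl : IsClosed (spectrum ℂ A) := spectrum.isClosed A
  let s : Set ℂ := Metric.ball 0 R \ spectrum ℂ A
  have hs : IsOpen s := Metric.isOpen_ball.sdiff hcl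
  obtain ⟨t, ρ, htc, hts, hρ, hcov, hdis⟩ := Besicovitch.exists_disjoint_closedBall_covering_ae
    (volume : Measure ℂ)
    (fun x => {r : ℝ | ‖x‖ + r ≤ R ∧ Disjoint (spectrum ℂ A) (Metric.closedBall x r)}) s
    (by
      intro x hx δ hδ
      obtain ⟨ε, hε, hb⟩ := Metric.isOpen_iff.1 hs x hx
      have hx1 : ‖x‖ < R := by simpa using hx.1
      refine ⟨min (min (ε / 2) (δ / 2)) (R - ‖x‖), ⟨?_, ?_⟩, ?_, ?_⟩
      · linarith [min_le_right (min (ε / 2) (δ / 2)) (R - ‖x‖)]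
      · rw [Set.disjoint_left]
        intro z hz hz'
        refine (hb (?_ : z ∈ Metric.ball x ε)).2 hz
        rw [Metric.mem_closedBall] at hz'
        rw [Metric.mem_ball]
        have h1 := min_le_left (min (ε / 2) (δ / 2)) (R - ‖x‖)
        have h2 := min_le_left (ε / 2) (δ / 2)
        linarith
      · exact lt_min (lt_min (by linarith) (by linarith)) (by linarith)
      · have h1 := min_le_left (min (ε / 2) (δ / 2)) (R - ‖x‖)
        have h2 := min_le_right (ε / 2) (δ / 2)
        linarith) (fun _ => 1) (fun _ _ => one_pos)
  have hfin : ∀ u : Finset t, ∑ i, dfc A (f i) + m * ∑ x ∈ u, ρ x ^ 2 ≤ m * R ^ 2 := by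
    intro u
    have := finset_bound A hA w hc R hR (u.map (Function.Embedding.subtype _)) ρ
      (by
        intro x hx
        obtain ⟨⟨y, hy⟩, _, rfl⟩ := Finset.mem_map.1 hx
        have := hρ y hy
        exact ⟨this.2.1, this.1.1, this.1.2⟩)
      (by
        intro x hx y hy hxy
        obtain ⟨⟨x, hx'⟩, _, rfl⟩ := Finset.mem_map.1 hx
        obtain ⟨⟨y, hy'⟩, _, rfl⟩ := Finset.mem_map.1 hy
        exact hdis hx' hy' hxy) f hf
    simpa using this
  have hc0 : 0 ≤ ∑ i, dfc A (f i) := Finset.sum_nonneg fun i _ => hA _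
  set c := ∑ i, dfc A (f i) with hcdef
  set S : ℝ≥0∞ := ∑' x : t, ENNReal.ofReal (ρ x) ^ 2 with hS
  have hmS : ENNReal.ofReal c + m * S ≤ m * ENNReal.ofReal R ^ 2 := by
    rw [hS, ← ENNReal.tsum_mul_left, ENNReal.tsum_eq_iSup_sum, ENNReal.add_iSup]
    refine iSup_le fun u => ?_
    have h := ENNReal.ofReal_le_ofReal (hfin u)
    have hsum : ENNReal.ofReal (∑ x ∈ u, ρ x ^ 2) = ∑ x ∈ u, ENNReal.ofReal (ρ x) ^ 2 := by
      rw [ENNReal.ofReal_sum_of_nonneg (fun _ _ => by positivity)]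
      refine Finset.sum_congr rfl fun x _ => ?_
      rw [ENNReal.ofReal_pow (hρ x x.2).2.1.le]
    rw [ENNReal.ofReal_add hc0 (by positivity), ENNReal.ofReal_mul (by positivity),
      ENNReal.ofReal_mul (by positivity), hsum,
      ENNReal.ofReal_pow hR0, ENNReal.ofReal_natCast] at h
    rw [← Finset.mul_sum]
    exact h
  have : Countable t := htc.to_subtype
  have hvol : ENNReal.ofReal R ^ 2 * ENNReal.ofReal Real.pi ≤
      volume (spectrum ℂ A) + S * ENNReal.ofReal Real.pi := by
    have hpi : ENNReal.ofReal Real.pi = (NNReal.pi : ℝ≥0∞) := by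
      rw [← NNReal.coe_real_pi, ENNReal.ofReal_coe_nnreal]
    rw [hpi, ← Complex.volume_ball 0 R]
    have hsub : Metric.ball (0:ℂ) R ⊆ spectrum ℂ A ∪ ((⋃ x ∈ t, Metric.closedBall x (ρ x)) ∪
        (s \ ⋃ x ∈ t, Metric.closedBall x (ρ x))) := by
      intro z hz
      by_cases h1 : z ∈ spectrum ℂ A
      · exact Or.inl h1
      · by_cases h2 : z ∈ ⋃ x ∈ t, Metric.closedBall x (ρ x)
        · exact Or.inr (Or.inl h2)
        · exact Or.inr (Or.inr ⟨⟨hz, h1⟩, h2⟩)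
    refine (measure_mono hsub).trans ((measure_union_le _ _).trans ?_)
    gcongr
    refine (measure_union_le _ _).trans ?_
    rw [hcov, add_zero, Set.biUnion_eq_iUnion, hS, ← ENNReal.tsum_mul_right]
    refine (measure_iUnion_le _).trans (le_of_eq ?_)
    simp [Complex.volume_closedBall]
  have hpi0 : ENNReal.ofReal Real.pi ≠ 0 := by simpa using Real.pi_pos
  have hpiT : ENNReal.ofReal Real.pi ≠ ⊤ := ENNReal.ofReal_ne_top
  have hmST : m * S ≠ ⊤ := by
    refine ne_top_of_le_ne_top ?_ (le_add_self.trans hmS)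
    exact ENNReal.mul_ne_top (ENNReal.natCast_ne_top m) (ENNReal.pow_ne_top ENNReal.ofReal_ne_top)
  refine (ENNReal.add_le_add_iff_right hmST).1 (hmS.trans ?_)
  have h1 : ENNReal.ofReal R ^ 2 ≤ volume (spectrum ℂ A) / ENNReal.ofReal Real.pi + S := by
    have h := ENNReal.div_le_div_right hvol (ENNReal.ofReal Real.pi)
    rwa [ENNReal.mul_div_cancel_right hpi0 hpiT, ENNReal.add_div,
      ENNReal.mul_div_cancel_right hpi0 hpiT] at h
  calc (m : ℝ≥0∞) * ENNReal.ofReal R ^ 2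
      ≤ m * (volume (spectrum ℂ A) / ENNReal.ofReal Real.pi + S) := by gcongr
    _ = _ := by rw [mul_add, div_eq_mul_inv, div_eq_mul_inv]; ring

lemma adjoint_cmt (A B : H →L[ℂ] H) : adjoint (cmt (adjoint A) B) = cmt (adjoint B) A := by
  simp only [cmt, ← star_eq_adjoint, star_sub, star_mul, star_star]

lemma joint_cs {d : ℕ} (T : Fin d → H →L[ℂ] H) (h : JointlyHyponormal T) (i j : Fin d) (x y : H) :
    0 ≤ dfc (T i) y ∧ 0 ≤ dfc (T j) x ∧
    ‖@inner ℂ _ _ y (cmt (adjoint (T j)) (T i) x)‖ ^ 2 ≤ dfc (T i) y * dfc (T j) x := by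
  set p : ℂ := @inner ℂ _ _ y (cmt (adjoint (T j)) (T i) x) with hp
  have hp' : @inner ℂ _ _ x (cmt (adjoint (T i)) (T j) y) = starRingEnd ℂ p := by
    rw [hp, ← adjoint_cmt, adjoint_inner_right, inner_conj_symm]
  have hi : @inner ℂ _ _ y (cmt (adjoint (T i)) (T i) y) = ((dfc (T i) y : ℝ) : ℂ) :=
    (dfc_eq_inner _ _).symm
  have hj : @inner ℂ _ _ x (cmt (adjoint (T j)) (T j) x) = ((dfc (T j) x : ℝ) : ℂ) :=
    (dfc_eq_inner _ _).symm
  have hB : ∀ (k l : Fin d) (u v : H), ∑ a, ∑ b, @inner ℂ _ _ ((Pi.single k u : Fin d → H) a)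
      (cmt (adjoint (T b)) (T a) ((Pi.single l v : Fin d → H) b)) =
      @inner ℂ _ _ u (cmt (adjoint (T l)) (T k) v) := by
    intro k l u v
    rw [Finset.sum_eq_single k, Finset.sum_eq_single l]
    · simp
    · intro b _ hb; simp [Pi.single_eq_of_ne hb]
    · simp
    · intro b _ hb; simp [Pi.single_eq_of_ne hb]
    · simp
  have hq : ∀ a b : ℂ, 0 ≤ (starRingEnd ℂ a * a * (dfc (T i) y : ℝ) + starRingEnd ℂ a * b * p +
      starRingEnd ℂ b * a * starRingEnd ℂ p + starRingEnd ℂ b * b * (dfc (T j) x : ℝ) : ℂ) := by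
    intro a b
    have h0 := h (Pi.single i (a • y) + Pi.single j (b • x))
    simp only [Pi.add_apply, map_add, inner_add_left, inner_add_right, Finset.sum_add_distrib,
      hB, map_smul, inner_smul_left, inner_smul_right, hi, hj, hp', ← hp] at h0
    convert h0 using 1
    ring
  have hdi : 0 ≤ dfc (T i) y := by simpa using hq 1 0
  have hdj : 0 ≤ dfc (T j) x := by simpa using hq 0 1
  refine ⟨hdi, hdj, ?_⟩
  have hs : ∀ s : ℝ, 0 ≤ (‖p‖ ^ 2 * dfc (T i) y) * (s * s) + (2 * ‖p‖ ^ 2) * s + dfc (T j) x := by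
    intro s
    have h0 := hq (s * p) 1
    have hpp : starRingEnd ℂ p * p = ((‖p‖ ^ 2 : ℝ) : ℂ) := by
      rw [Complex.conj_mul']; push_cast; rfl
    have e : (starRingEnd ℂ (s * p) * (s * p) * (dfc (T i) y : ℝ) + starRingEnd ℂ (s * p) * 1 * p +
      starRingEnd ℂ 1 * (s * p) * starRingEnd ℂ p + starRingEnd ℂ 1 * 1 * (dfc (T j) x : ℝ) : ℂ)
      = (((‖p‖ ^ 2 * dfc (T i) y) * (s * s) + (2 * ‖p‖ ^ 2) * s + dfc (T j) x : ℝ) : ℂ) := by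
      push_cast at hpp ⊢
      simp only [map_mul, Complex.conj_ofReal, map_one]
      linear_combination (s * s * (dfc (T i) y : ℂ) + 2 * s) * hpp
    rw [e] at h0
    exact_mod_cast h0
  have hd := discrim_le_zero hs
  rw [discrim] at hd
  rcases eq_or_ne p 0 with h0 | h0
  · rw [h0]; simpa using mul_nonneg hdi hdj
  · have : 0 < ‖p‖ ^ 2 := by positivity
    nlinarith

lemma exists_enum (T : H →L[ℂ] H) (m : ℕ) (h : IsPolyCyclicOp T m) :
    ∃ w : Fin m → H, ∀ Z, RCyc T w Z := by
  obtain ⟨ξ, hξ, hd⟩ := h.1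
  subst hξ
  refine ⟨fun i => ξ.equivFin.symm i, RCyc_of_dense T _ ?_⟩
  have e : Set.range (fun i => (ξ.equivFin.symm i : H)) = (ξ : Set H) := by
    ext z
    constructor
    · rintro ⟨i, rfl⟩; exact (ξ.equivFin.symm i).2
    · intro hz; exact ⟨ξ.equivFin ⟨z, hz⟩, by simp⟩
  rw [e]
  exact hd

/-- The uniform trace norm bound. -/
lemma trace_bound {d : ℕ} (T : Fin d → H →L[ℂ] H) (hjh : JointlyHyponormal T) (m : Fin d → ℕ)
    (hcyc : ∀ i, IsPolyCyclicOp (T i) (m i)) (i j : Fin d) :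
    traceNorm (cmt (adjoint (T j)) (T i)) ≤
        ((m i : ℝ≥0∞) / ENNReal.ofReal Real.pi * volume (spectrum ℂ (T i))) ^ (1/2 : ℝ) *
          ((m j : ℝ≥0∞) / ENNReal.ofReal Real.pi * volume (spectrum ℂ (T j))) ^ (1/2 : ℝ) := by
  have hpos : ∀ k x, 0 ≤ dfc (T k) x := fun k x => (joint_cs T hjh k k x x).1
  have hbs : ∀ (k : Fin d) (n : ℕ) (f : Fin n → H), Orthonormal ℂ f →
      ENNReal.ofReal (∑ l, dfc (T k) (f l)) ≤
      (m k : ℝ≥0∞) / ENNReal.ofReal Real.pi * volume (spectrum ℂ (T k)) := by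
    intro k n f hf
    obtain ⟨w, hw⟩ := exists_enum (T k) (m k) (hcyc k)
    exact berger_shaw (T k) (hpos k) w hw f hf
  rw [traceNorm]
  refine iSup_le fun n => iSup_le fun f => iSup_le fun g => iSup_le fun hf => iSup_le fun hg => ?_
  have h1 : ∑ k, ‖@inner ℂ _ _ (cmt (adjoint (T j)) (T i) (f k)) (g k)‖ ≤
      √(∑ k, dfc (T i) (g k)) * √(∑ k, dfc (T j) (f k)) := by
    refine le_trans (Finset.sum_le_sum fun k _ => ?_)
      (Real.sum_sqrt_mul_sqrt_le Finset.univ (fun k => hpos i (g k)) (fun k => hpos j (f k)))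
    rw [norm_inner_symm, ← Real.sqrt_mul (hpos _ _)]
    exact Real.le_sqrt_of_sq_le (joint_cs T hjh i j (f k) (g k)).2.2
  have hr : ∀ a : ℝ, 0 ≤ a → ENNReal.ofReal √a = ENNReal.ofReal a ^ (1/2 : ℝ) := by
    intro a ha
    rw [Real.sqrt_eq_rpow, ENNReal.ofReal_rpow_of_nonneg ha (by norm_num)]
  calc ∑ k, (‖@inner ℂ _ _ (cmt (adjoint (T j)) (T i) (f k)) (g k)‖₊ : ℝ≥0∞)
      = ENNReal.ofReal (∑ k, ‖@inner ℂ _ _ (cmt (adjoint (T j)) (T i) (f k)) (g k)‖) := by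
        rw [ENNReal.ofReal_sum_of_nonneg (fun _ _ => norm_nonneg _)]
        refine Finset.sum_congr rfl fun k _ => ?_
        rw [ofReal_norm]; rfl
    _ ≤ ENNReal.ofReal (√(∑ k, dfc (T i) (g k)) * √(∑ k, dfc (T j) (f k))) :=
        ENNReal.ofReal_le_ofReal h1
    _ = ENNReal.ofReal (∑ k, dfc (T i) (g k)) ^ (1/2 : ℝ) *
        ENNReal.ofReal (∑ k, dfc (T j) (f k)) ^ (1/2 : ℝ) := by
        rw [ENNReal.ofReal_mul (Real.sqrt_nonneg _),
          hr _ (Finset.sum_nonneg fun k _ => hpos i (g k)),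
          hr _ (Finset.sum_nonneg fun k _ => hpos j (f k))]
    _ ≤ _ := mul_le_mul' (ENNReal.rpow_le_rpow (hbs i n g hg) (by norm_num))
        (ENNReal.rpow_le_rpow (hbs j n f hf) (by norm_num))

/-- Berger-Shaw type trace bounds for a jointly hyponormal commuting tuple whose
members are individually polynomially cyclic. -/
theorem statement_7 {d : ℕ} [TopologicalSpace.SeparableSpace H]
    (T : Fin d → H →L[ℂ] H) (hcomm : ∀ i j, Commute (T i) (T j))
    (hjh : JointlyHyponormal T) (m : Fin d → ℕ) (hcyc : ∀ i, IsPolyCyclicOp (T i) (m i)) :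
    (∀ i j, IsTraceClass (cmt (adjoint (T j)) (T i))) ∧
    (∀ i, traceNorm (cmt (adjoint (T i)) (T i)) ≤
        (m i : ℝ≥0∞) / ENNReal.ofReal Real.pi * volume (spectrum ℂ (T i))) ∧
    (∀ i j, i ≠ j → traceNorm (cmt (adjoint (T j)) (T i)) ≤
        ((m i : ℝ≥0∞) / ENNReal.ofReal Real.pi * volume (spectrum ℂ (T i))) ^ (1/2 : ℝ) *
          ((m j : ℝ≥0∞) / ENNReal.ofReal Real.pi * volume (spectrum ℂ (T j))) ^ (1/2 : ℝ)) := by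
  have hfin : ∀ i, (m i : ℝ≥0∞) / ENNReal.ofReal Real.pi * volume (spectrum ℂ (T i)) ≠ ⊤ := by
    intro i
    refine ENNReal.mul_ne_top (ENNReal.div_ne_top (ENNReal.natCast_ne_top _) ?_)
      (spectrum.isCompact (T i)).measure_lt_top.ne
    simpa using Real.pi_pos
  refine ⟨fun i j => ?_, fun i => ?_, fun i j _ => trace_bound T hjh m hcyc i j⟩
  · refine ne_top_of_le_ne_top ?_ (trace_bound T hjh m hcyc i j)
    exact ENNReal.mul_ne_top (ENNReal.rpow_ne_top_of_nonneg (by norm_num) (hfin i))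
      (ENNReal.rpow_ne_top_of_nonneg (by norm_num) (hfin j))
  · refine (trace_bound T hjh m hcyc i i).trans (le_of_eq ?_)
    rw [← ENNReal.rpow_add_of_nonneg _ _ (by norm_num) (by norm_num)]
    norm_num
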